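/- arXiv:2512.01269 — 7 statements merged into one kernel-verified Lean document; each statement's English description precedes it below -/
import Mathlib

section
/- Suppose ν is a Borel probability measure on X and the point x₀ is ν-generic for g. Then for every real t ≥ 1, ν(Λ_t) is at least the upper density of H_t, i.e. ν(Λ_t) ≥ limsup_{n→∞} #(H_t ∩ {0,…,n−1})/n. (Lemma 3.3(2) of the paper, stated for the abstract resonance-block construction.) -/
open Set Filter Topology MeasureTheory
open scoped Classical

noncomputable section

variable {X : Type*}

/-- `n ∈ H_t`: equivalent to `a¹_n ≤ t ∧ a²_n ≤ t` in the resonance-block construction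
(all the defining ratios are bounded by `t`, products written multiplicatively since
`φE, φF > 0` and `cE, cF > 0`). -/
def memH (g : Equiv.Perm X) (x₀ : X) (φE φF : X → ℝ) (cE cF t : ℝ) (n : ℕ) : Prop :=
  (∀ j ≤ n,
      (∏ i ∈ Finset.Ico (n - j) n, φF ((g ^ i) x₀)) ≤ t * cF ^ j ∧
      cE ^ j ≤ t * ∏ i ∈ Finset.Ico (n - j) n, φE ((g ^ i) x₀)) ∧
  (∀ j : ℕ,
      (∏ i ∈ Finset.Ico n (n + j), φF ((g ^ i) x₀)) ≤ t * cF ^ j ∧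
      cE ^ j ≤ t * ∏ i ∈ Finset.Ico n (n + j), φE ((g ^ i) x₀))

/-- The resonance block `Λ_t = ⋂_{m ≥ 1} closure {gʲ(x₀) : j ∈ H_t, j ≥ m}`. -/
def block [TopologicalSpace X] (g : Equiv.Perm X) (x₀ : X) (φE φF : X → ℝ)
    (cE cF t : ℝ) : Set X :=
  ⋂ m ∈ {m : ℕ | 1 ≤ m},
    closure ((fun j : ℕ => (g ^ j) x₀) '' {j | memH g x₀ φE φF cE cF t j ∧ m ≤ j})

/-- `R = ⋃_{t ≥ 1} Λ_t`. -/
def blockUnion [TopologicalSpace X] (g : Equiv.Perm X) (x₀ : X) (φE φF : X → ℝ)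
    (cE cF : ℝ) : Set X :=
  ⋃ t ∈ {t : ℝ | 1 ≤ t}, block g x₀ φE φF cE cF t

/-- `T(x) = inf {t ≥ 1 : x ∈ Λ_t}`. -/
def Tfun [TopologicalSpace X] (g : Equiv.Perm X) (x₀ : X) (φE φF : X → ℝ)
    (cE cF : ℝ) (x : X) : ℝ :=
  sInf {t : ℝ | 1 ≤ t ∧ x ∈ block g x₀ φE φF cE cF t}

/-- If the empirical averages along a sequence `u` converge to integrals against `ν`, then every
closed set containing `u j` for all large `j` with `P j` has measure at least the upper density
of `P`. -/
theorem ofReal_limsup_card_div_le_measure_of_isClosed [MetricSpace X] [MeasurableSpace X]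
    [BorelSpace X] (ν : Measure X) [IsProbabilityMeasure ν] (u : ℕ → X)
    (hu : ∀ φ : X → ℝ, Continuous φ →
      Tendsto (fun n : ℕ => (∑ i ∈ Finset.range n, φ (u i)) / (n : ℝ))
        atTop (𝓝 (∫ x, φ x ∂ν)))
    (P : ℕ → Prop) (m : ℕ) {K : Set X} (hK : IsClosed K) (hPK : ∀ j, P j → m ≤ j → u j ∈ K) :
    ENNReal.ofReal (limsup (fun n : ℕ => (((Finset.range n).filter P).card : ℝ) / n) atTop)
      ≤ ν K := by
  refine ge_of_tendsto' (tendsto_lintegral_thickenedIndicator_of_isClosed ν hK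
    (fun k => Nat.one_div_pos_of_nat (α := ℝ) (n := k))
    tendsto_one_div_add_atTop_nhds_zero_nat) fun k => ?_
  set f := thickenedIndicator (Nat.one_div_pos_of_nat (α := ℝ) (n := k)) K with hf
  have hcont : Continuous fun x => (f x : ℝ) := NNReal.continuous_coe.comp f.continuous
  have hint : ENNReal.ofReal (∫ x, (f x : ℝ) ∂ν) = ∫⁻ x, (f x : ENNReal) ∂ν := by
    rw [← BoundedContinuousFunction.toReal_lintegral_coe_eq_integral,
      ENNReal.ofReal_toReal (f.lintegral_lt_top_of_nnreal ν).ne]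
  rw [← hint]
  refine ENNReal.ofReal_le_ofReal ?_
  have hlim : Tendsto (fun n : ℕ => (m : ℝ) / n + (∑ i ∈ Finset.range n, (f (u i) : ℝ)) / n)
      atTop (𝓝 (∫ x, (f x : ℝ) ∂ν)) := by
    simpa using (tendsto_const_div_atTop_nhds_zero_nat (m : ℝ)).add (hu _ hcont)
  rw [← hlim.limsup_eq]
  refine limsup_le_limsup (Eventually.of_forall fun n => ?_)
    (IsBoundedUnder.isCoboundedUnder_le (isBoundedUnder_of ⟨0, fun n => by positivity⟩))
    hlim.isBoundedUnder_le
  beta_reduce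
  rw [← add_div]
  refine div_le_div_of_nonneg_right ?_ n.cast_nonneg
  have hsub : (Finset.range n).filter P ⊆
      Finset.range m ∪ (Finset.range n).filter fun j => P j ∧ m ≤ j := by
    intro j
    simp only [Finset.mem_filter, Finset.mem_union, Finset.mem_range]
    grind
  calc (((Finset.range n).filter P).card : ℝ)
      ≤ m + ((Finset.range n).filter fun j => P j ∧ m ≤ j).card := by
        exact_mod_cast (Finset.card_le_card hsub).trans
          ((Finset.card_union_le _ _).trans_eq (by rw [Finset.card_range]))
    _ = m + ∑ i ∈ Finset.range n, if P i ∧ m ≤ i then (1 : ℝ) else 0 := by simp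
    _ ≤ m + ∑ i ∈ Finset.range n, (f (u i) : ℝ) := by
        gcongr with i _
        split_ifs with h
        · rw [hf, thickenedIndicator_one _ _ (hPK i h.1 h.2), NNReal.coe_one]
        · exact NNReal.coe_nonneg _

/-- Lemma 3.3(2): if `x₀` is `ν`-generic for `g`, then for every `t ≥ 1`,
`ν(Λ_t)` is at least the upper density of `H_t`. -/
theorem stmt_1 [MetricSpace X] [CompactSpace X] [MeasurableSpace X] [BorelSpace X]
    (g : Equiv.Perm X) (hg : Continuous ⇑g) (hg' : Continuous ⇑g.symm)
    (x₀ : X) (φE φF : X → ℝ) (hφE : Continuous φE) (hφF : Continuous φF)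
    (hφEpos : ∀ x, 0 < φE x) (hφFpos : ∀ x, 0 < φF x)
    (cE cF : ℝ) (hcE : 0 < cE) (hcF : 0 < cF)
    (ν : Measure X) [IsProbabilityMeasure ν]
    (hgen : ∀ φ : X → ℝ, Continuous φ →
      Tendsto (fun n : ℕ => (∑ i ∈ Finset.range n, φ ((g ^ i) x₀)) / (n : ℝ))
        atTop (𝓝 (∫ x, φ x ∂ν))) :
    ∀ t : ℝ, 1 ≤ t →
      ENNReal.ofReal (limsup (fun n : ℕ =>
          (((Finset.range n).filter fun j => memH g x₀ φE φF cE cF t j).card : ℝ) / n) atTop)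
        ≤ ν (block g x₀ φE φF cE cF t) := by
  intro t _
  set A : ℕ → Set X := fun m =>
    closure ((fun j : ℕ => (g ^ j) x₀) '' {j | memH g x₀ φE φF cE cF t j ∧ m + 1 ≤ j}) with hA
  have hblock : block g x₀ φE φF cE cF t = ⋂ m, A m := by
    ext x
    simp only [block, mem_iInter, mem_ofPred_eq, hA]
    refine ⟨fun h m => h (m + 1) (by lia), fun h m hm => ?_⟩
    obtain ⟨k, rfl⟩ := Nat.exists_eq_add_of_le' hm
    exact h k
  have hanti : Antitone A := fun a b hab =>
    closure_mono (image_mono fun j hj => ⟨hj.1, by have := hj.2; lia⟩)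
  rw [hblock, hanti.measure_iInter (fun m => isClosed_closure.nullMeasurableSet)
    ⟨0, measure_ne_top ν _⟩]
  exact le_iInf fun m => ofReal_limsup_card_div_le_measure_of_isClosed ν (fun j => (g ^ j) x₀)
    hgen _ (m + 1) isClosed_closure fun j hj hmj => subset_closure ⟨j, ⟨hj, hmj⟩, rfl⟩
end
end

section
/- There exists a constant c₀ ≥ 1 (one may take c₀ = max{1, max_{x∈X} φ_F(x)/c_F, max_{x∈X} c_F/φ_F(x), max_{x∈X} c_E/φ_E(x), max_{x∈X} φ_E(x)/c_E}, which is finite by compactness of X and continuity and positivity of φ_E, φ_F) such that g(Λ_t) ⊆ Λ_{c₀·t} for every real t ≥ 1. (Lemma 3.3(3) of the paper, stated for the abstract resonance-block construction.) -/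
open Set Filter Topology MeasureTheory
open scoped Classical

noncomputable section

variable {X : Type*}

/-- Shifting a backward product bound by one index costs at most a factor `C`. -/
lemma prod_Ico_succ_backward_le {u : ℕ → ℝ} {c C t : ℝ} {n : ℕ} (hu : ∀ i, 0 < u i)
    (hc : 0 < c) (hC : 1 ≤ C) (ht : 1 ≤ t) (huC : ∀ i, u i ≤ C * c)
    (h : ∀ j ≤ n, ∏ i ∈ Finset.Ico (n - j) n, u i ≤ t * c ^ j) :
    ∀ j ≤ n + 1, ∏ i ∈ Finset.Ico (n + 1 - j) (n + 1), u i ≤ C * t * c ^ j := by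
  rintro (_ | k) hj
  · simpa using one_le_mul_of_one_le_of_one_le hC ht
  · rw [Nat.add_sub_add_right, Finset.prod_Ico_succ_top (Nat.sub_le n k)]
    calc (∏ i ∈ Finset.Ico (n - k) n, u i) * u n ≤ (t * c ^ k) * (C * c) :=
          mul_le_mul (h k (by omega)) (huC n) (hu n).le (by positivity)
      _ = C * t * c ^ (k + 1) := by ring

/-- Shifting a forward product bound by one index costs at most a factor `C`. -/
lemma prod_Ico_succ_forward_le {u : ℕ → ℝ} {c C t : ℝ} {n : ℕ} (hu : ∀ i, 0 < u i)
    (hc : 0 < c) (ht : 1 ≤ t) (hcu : ∀ i, c ≤ C * u i)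
    (h : ∀ j, ∏ i ∈ Finset.Ico n (n + j), u i ≤ t * c ^ j) (j : ℕ) :
    ∏ i ∈ Finset.Ico (n + 1) (n + 1 + j), u i ≤ C * t * c ^ j := by
  have hprod := h (j + 1)
  rw [Finset.prod_eq_prod_Ico_succ_bot (by omega), show n + (j + 1) = n + 1 + j by omega]
    at hprod
  refine le_of_mul_le_mul_left ?_ (hu n)
  calc u n * ∏ i ∈ Finset.Ico (n + 1) (n + 1 + j), u i ≤ t * c ^ j * c := by
        rw [mul_assoc, ← pow_succ]; exact hprod
    _ ≤ t * c ^ j * (C * u n) := mul_le_mul_of_nonneg_left (hcu n) (by positivity)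
    _ = u n * (C * t * c ^ j) := by ring

lemma prod_inv_le_mul_inv_pow_iff {u : ℕ → ℝ} {c t : ℝ} (s : Finset ℕ) (j : ℕ)
    (hu : ∀ i, 0 < u i) (hc : 0 < c) :
    ∏ i ∈ s, (u i)⁻¹ ≤ t * c⁻¹ ^ j ↔ c ^ j ≤ t * ∏ i ∈ s, u i := by
  have hs : 0 < ∏ i ∈ s, u i := Finset.prod_pos fun i _ => hu i
  rw [Finset.prod_inv_distrib, inv_pow, ← div_eq_mul_inv, le_div_iff₀ (pow_pos hc j),
    inv_mul_le_iff₀ hs, mul_comm t]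

lemma memH_succ {g : Equiv.Perm X} {x₀ : X} {φE φF : X → ℝ} {cE cF C t : ℝ} {n : ℕ}
    (hφE : ∀ x, 0 < φE x) (hφF : ∀ x, 0 < φF x) (hcE : 0 < cE) (hcF : 0 < cF)
    (hC : 1 ≤ C) (ht : 1 ≤ t)
    (hF : ∀ x, φF x ≤ C * cF) (hF' : ∀ x, cF ≤ C * φF x)
    (hE : ∀ x, φE x ≤ C * cE) (hE' : ∀ x, cE ≤ C * φE x)
    (h : memH g x₀ φE φF cE cF t n) :
    memH g x₀ φE φF cE cF (C * t) (n + 1) := by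
  have hinv : ∀ {a b : ℝ}, 0 < a → 0 < b → a ≤ C * b → b⁻¹ ≤ C * a⁻¹ := by
    intro a b ha hb hab
    rwa [← div_eq_mul_inv, le_div_iff₀ ha, inv_mul_le_iff₀ hb, mul_comm b]
  have hiff : ∀ (r : ℝ) (s : Finset ℕ) (j : ℕ),
      ∏ i ∈ s, (φE ((g ^ i) x₀))⁻¹ ≤ r * cE⁻¹ ^ j ↔
        cE ^ j ≤ r * ∏ i ∈ s, φE ((g ^ i) x₀) :=
    fun r s j => prod_inv_le_mul_inv_pow_iff s j (fun i => hφE _) hcE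
  refine ⟨fun j hj => ⟨?_, ?_⟩, fun j => ⟨?_, ?_⟩⟩
  · exact prod_Ico_succ_backward_le (fun i => hφF _) hcF hC ht (fun i => hF _)
      (fun k hk => (h.1 k hk).1) j hj
  · rw [← hiff]
    exact prod_Ico_succ_backward_le (fun i => inv_pos.2 (hφE _)) (inv_pos.2 hcE) hC ht
      (fun i => hinv hcE (hφE _) (hE' _)) (fun k hk => (hiff _ _ _).2 (h.1 k hk).2) j hj
  · exact prod_Ico_succ_forward_le (fun i => hφF _) hcF ht (fun i => hF' _)
      (fun k => (h.2 k).1) j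
  · rw [← hiff]
    exact prod_Ico_succ_forward_le (fun i => inv_pos.2 (hφE _)) (inv_pos.2 hcE) ht
      (fun i => hinv (hφE _) hcE (hE _)) (fun k => (hiff _ _ _).2 (h.2 k).2) j

lemma exists_forall_le_mul_const_and_const_le_mul [TopologicalSpace X] [CompactSpace X]
    {φ : X → ℝ} {c : ℝ} (hφ : Continuous φ) (hpos : ∀ x, 0 < φ x) (hc : 0 < c) :
    ∃ C : ℝ, ∀ x, φ x ≤ C * c ∧ c ≤ C * φ x := by
  have hcont : Continuous fun x => max (φ x / c) (c / φ x) :=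
    (hφ.div_const c).max (continuous_const.div hφ fun x => (hpos x).ne')
  obtain ⟨C, hC⟩ := (isCompact_range hcont).bddAbove
  refine ⟨C, fun x => ?_⟩
  have hx := max_le_iff.1 (hC (mem_range_self x))
  exact ⟨(div_le_iff₀ hc).1 hx.1, (div_le_iff₀ (hpos x)).1 hx.2⟩

/-- Lemma 3.3(3): there is a constant `c₀ ≥ 1` with `g(Λ_t) ⊆ Λ_{c₀·t}` for all `t ≥ 1`. -/
theorem stmt_2 [MetricSpace X] [CompactSpace X]
    (g : Equiv.Perm X) (hg : Continuous ⇑g) (hg' : Continuous ⇑g.symm)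
    (x₀ : X) (φE φF : X → ℝ) (hφE : Continuous φE) (hφF : Continuous φF)
    (hφEpos : ∀ x, 0 < φE x) (hφFpos : ∀ x, 0 < φF x)
    (cE cF : ℝ) (hcE : 0 < cE) (hcF : 0 < cF) :
    ∃ c₀ : ℝ, 1 ≤ c₀ ∧ ∀ t : ℝ, 1 ≤ t →
      ⇑g '' block g x₀ φE φF cE cF t ⊆ block g x₀ φE φF cE cF (c₀ * t) := by
  obtain ⟨A, hA⟩ := exists_forall_le_mul_const_and_const_le_mul hφE hφEpos hcE
  obtain ⟨B, hB⟩ := exists_forall_le_mul_const_and_const_le_mul hφF hφFpos hcF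
  have hAC : A ≤ max 1 (max A B) := (le_max_left A B).trans (le_max_right _ _)
  have hBC : B ≤ max 1 (max A B) := (le_max_right A B).trans (le_max_right _ _)
  refine ⟨max 1 (max A B), le_max_left _ _, fun t ht => ?_⟩
  rintro _ ⟨x, hx, rfl⟩
  simp only [block, mem_iInter] at hx ⊢
  intro m hm
  refine map_mem_closure hg (hx m hm) ?_
  rintro _ ⟨n, ⟨hn, hmn⟩, rfl⟩
  refine ⟨n + 1, ⟨memH_succ hφEpos hφFpos hcE hcF (le_max_left _ _) ht ?_ ?_ ?_ ?_ hn,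
    Nat.le_succ_of_le hmn⟩, ?_⟩
  · exact fun y => (hB y).1.trans (mul_le_mul_of_nonneg_right hBC hcF.le)
  · exact fun y => (hB y).2.trans (mul_le_mul_of_nonneg_right hBC (hφFpos y).le)
  · exact fun y => (hA y).1.trans (mul_le_mul_of_nonneg_right hAC hcE.le)
  · exact fun y => (hA y).2.trans (mul_le_mul_of_nonneg_right hAC (hφEpos y).le)
  · simp only [pow_succ', Equiv.Perm.mul_apply]
end
end

section
/- Suppose ν is a g-invariant Borel probability measure on X such that the measure-preserving system (X, g, ν) is ergodic, the point x₀ is ν-generic for g, and for some real t₀ ≥ 1 the upper density of H_{t₀} is strictly positive. Then ν(⋃_{t ≥ 1} Λ_t) = 1 and ν(Λ_t) → 1 as t → ∞. (Lemma 3.5 of the paper, stated for the abstract resonance-block construction.) -/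
open Set Filter Topology MeasureTheory
open scoped Classical

noncomputable section

variable {X : Type*}

section ResonanceBlock

theorem memH.mono {g : Equiv.Perm X} {x₀ : X} {φE φF : X → ℝ} {cE cF : ℝ}
    (hφEpos : ∀ x, 0 < φE x) (hcF : 0 < cF) {s t : ℝ} (hst : s ≤ t) {n : ℕ}
    (h : memH g x₀ φE φF cE cF s n) : memH g x₀ φE φF cE cF t n := by
  have hE : ∀ A : Finset ℕ, 0 ≤ ∏ i ∈ A, φE ((g ^ i) x₀) :=
    fun A => Finset.prod_nonneg fun i _ => (hφEpos _).le
  exact ⟨fun j hj => ⟨(h.1 j hj).1.trans (by gcongr),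
      (h.1 j hj).2.trans (mul_le_mul_of_nonneg_right hst (hE _))⟩,
    fun j => ⟨(h.2 j).1.trans (by gcongr),
      (h.2 j).2.trans (mul_le_mul_of_nonneg_right hst (hE _))⟩⟩

theorem block_mono [TopologicalSpace X] {g : Equiv.Perm X} {x₀ : X} {φE φF : X → ℝ}
    {cE cF : ℝ} (hφEpos : ∀ x, 0 < φE x) (hcF : 0 < cF) :
    Monotone (block g x₀ φE φF cE cF) := fun _ _ hst =>
  iInter₂_mono fun _ _ => closure_mono <| image_mono fun _ hj =>
    ⟨hj.1.mono hφEpos hcF hst, hj.2⟩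

theorem isClosed_block [TopologicalSpace X] (g : Equiv.Perm X) (x₀ : X) (φE φF : X → ℝ)
    (cE cF t : ℝ) : IsClosed (block g x₀ φE φF cE cF t) :=
  isClosed_biInter fun _ _ => isClosed_closure

theorem blockUnion_eq_iUnion [TopologicalSpace X] {g : Equiv.Perm X} {x₀ : X}
    {φE φF : X → ℝ} {cE cF : ℝ} (hφEpos : ∀ x, 0 < φE x) (hcF : 0 < cF) :
    blockUnion g x₀ φE φF cE cF = ⋃ t : ℝ, block g x₀ φE φF cE cF t := by
  refine Subset.antisymm (iUnion₂_subset fun t _ => subset_iUnion _ t)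
    (iUnion_subset fun t => ?_)
  exact (block_mono hφEpos hcF (le_max_right 1 t)).trans
    (subset_biUnion_of_mem (u := block g x₀ φE φF cE cF)
      (show max 1 t ∈ {t : ℝ | 1 ≤ t} from le_max_left 1 t))

theorem measurableSet_iUnion_of_monotone_of_isClosed [TopologicalSpace X] [MeasurableSpace X]
    [BorelSpace X] {s : ℝ → Set X} (hs : Monotone s) (hc : ∀ t, IsClosed (s t)) :
    MeasurableSet (⋃ t, s t) := by
  have : ⋃ t, s t = ⋃ n : ℕ, s n := by
    refine Subset.antisymm (iUnion_subset fun t => ?_) (iUnion_subset fun n => subset_iUnion s _)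
    obtain ⟨n, hn⟩ := exists_nat_ge t
    exact (hs hn).trans (subset_iUnion (fun n : ℕ => s n) n)
  rw [this]
  exact MeasurableSet.iUnion fun n => (hc n).measurableSet

theorem exists_ratio_bound [TopologicalSpace X] [CompactSpace X] {φ : X → ℝ}
    (hφ : Continuous φ) (hpos : ∀ x, 0 < φ x) {c : ℝ} (hc : 0 < c) :
    ∃ C : ℝ, 1 ≤ C ∧ ∀ x, φ x ≤ C * c ∧ c ≤ C * φ x := by
  have h1 : Continuous fun x => max (φ x / c) (c / φ x) :=
    (hφ.div_const c).max (continuous_const.div hφ fun x => (hpos x).ne')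
  obtain ⟨B, hB⟩ := (isCompact_range h1).bddAbove
  refine ⟨max 1 B, le_max_left _ _, fun x => ?_⟩
  have hx : max (φ x / c) (c / φ x) ≤ max 1 B := (hB ⟨x, rfl⟩).trans (le_max_right _ _)
  exact ⟨(div_le_iff₀ hc).1 ((le_max_left _ _).trans hx),
    (div_le_iff₀ (hpos x)).1 ((le_max_right _ _).trans hx)⟩

theorem memH.succ {g : Equiv.Perm X} {x₀ : X} {φE φF : X → ℝ} {cE cF C : ℝ}
    (hφEpos : ∀ x, 0 < φE x) (hφFpos : ∀ x, 0 < φF x) (hcE : 0 < cE) (hcF : 0 < cF)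
    (hC : 1 ≤ C) (hCE : ∀ x, cE ≤ C * φE x ∧ φE x ≤ C * cE)
    (hCF : ∀ x, φF x ≤ C * cF ∧ cF ≤ C * φF x) {t : ℝ} {n : ℕ}
    (h : memH g x₀ φE φF cE cF t n) : memH g x₀ φE φF cE cF (C * t) (n + 1) := by
  have ht : 1 ≤ t := by simpa using (h.1 0 (Nat.zero_le n)).1
  have hE : ∀ A : Finset ℕ, 0 ≤ ∏ i ∈ A, φE ((g ^ i) x₀) :=
    fun A => Finset.prod_nonneg fun i _ => (hφEpos _).le
  have hF : ∀ A : Finset ℕ, 0 ≤ ∏ i ∈ A, φF ((g ^ i) x₀) :=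
    fun A => Finset.prod_nonneg fun i _ => (hφFpos _).le
  set y := (g ^ n) x₀ with hy
  obtain ⟨hE1, hE2⟩ := hCE y
  obtain ⟨hF1, hF2⟩ := hCF y
  constructor
  · rintro (_ | k) hk
    · have : 1 ≤ C * t := one_le_mul_of_one_le_of_one_le hC ht
      simpa using this
    · obtain ⟨h1, h2⟩ := h.1 k (by omega)
      rw [Nat.add_sub_add_right, Finset.prod_Ico_succ_top (Nat.sub_le n k),
        Finset.prod_Ico_succ_top (Nat.sub_le n k), ← hy]
      constructor
      · calc _ ≤ (t * cF ^ k) * (C * cF) :=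
              mul_le_mul h1 hF1 (hφFpos y).le (by positivity)
          _ = _ := by ring
      · calc cE ^ (k + 1) = cE ^ k * cE := pow_succ _ _
          _ ≤ (t * ∏ i ∈ Finset.Ico (n - k) n, φE ((g ^ i) x₀)) * (C * φE y) :=
              mul_le_mul h2 hE1 hcE.le (mul_nonneg (by positivity) (hE _))
          _ = _ := by ring
  · intro j
    obtain ⟨h1, h2⟩ := h.2 (j + 1)
    rw [Finset.prod_eq_prod_Ico_succ_bot (by omega), ← hy,
      show n + (j + 1) = n + 1 + j by ring] at h1 h2
    set P := ∏ i ∈ Finset.Ico (n + 1) (n + 1 + j), φF ((g ^ i) x₀)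
    set Q := ∏ i ∈ Finset.Ico (n + 1) (n + 1 + j), φE ((g ^ i) x₀)
    have hP : 0 ≤ P := hF _
    have hQ : 0 ≤ Q := hE _
    constructor
    · refine le_of_mul_le_mul_right ?_ hcF
      calc P * cF ≤ P * (C * φF y) := by gcongr
        _ = C * (φF y * P) := by ring
        _ ≤ C * (t * cF ^ (j + 1)) := by gcongr
        _ = _ := by ring
    · refine le_of_mul_le_mul_right ?_ hcE
      calc cE ^ j * cE = cE ^ (j + 1) := (pow_succ _ _).symm
        _ ≤ t * (φE y * Q) := h2
        _ ≤ t * (C * cE * Q) := by gcongr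
        _ = _ := by ring

theorem exists_mapsTo_block [TopologicalSpace X] [CompactSpace X]
    {g : Equiv.Perm X} (hg : Continuous ⇑g) (x₀ : X) {φE φF : X → ℝ} (hφE : Continuous φE)
    (hφF : Continuous φF) (hφEpos : ∀ x, 0 < φE x) (hφFpos : ∀ x, 0 < φF x)
    {cE cF : ℝ} (hcE : 0 < cE) (hcF : 0 < cF) :
    ∃ C : ℝ, ∀ t,
      MapsTo g (block g x₀ φE φF cE cF t) (block g x₀ φE φF cE cF (C * t)) := by
  obtain ⟨C₁, hC₁, h₁⟩ := exists_ratio_bound hφE hφEpos hcE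
  obtain ⟨C₂, hC₂, h₂⟩ := exists_ratio_bound hφF hφFpos hcF
  have hl := le_max_left C₁ C₂
  have hr := le_max_right C₁ C₂
  refine ⟨max C₁ C₂, fun t x hx => mem_iInter₂.2 fun m hm => ?_⟩
  have hmaps : MapsTo g
      ((fun j : ℕ => (g ^ j) x₀) '' {j | memH g x₀ φE φF cE cF t j ∧ m ≤ j})
      ((fun j : ℕ => (g ^ j) x₀) ''
        {j | memH g x₀ φE φF cE cF (max C₁ C₂ * t) j ∧ m ≤ j}) := by
    rintro _ ⟨j, hj, rfl⟩
    refine ⟨j + 1, ⟨hj.1.succ hφEpos hφFpos hcE hcF (hC₁.trans hl)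
      (fun x => ⟨(h₁ x).2.trans ?_, (h₁ x).1.trans ?_⟩)
      (fun x => ⟨(h₂ x).1.trans ?_, (h₂ x).2.trans ?_⟩), hj.2.trans (Nat.le_succ j)⟩, ?_⟩
    · exact mul_le_mul_of_nonneg_right hl (hφEpos x).le
    · exact mul_le_mul_of_nonneg_right hl hcE.le
    · exact mul_le_mul_of_nonneg_right hr hcF.le
    · exact mul_le_mul_of_nonneg_right hr (hφFpos x).le
    · simp [pow_succ']
  exact hmaps.closure hg (mem_iInter₂.1 hx m hm)

/-- Along a generic sequence, the upper density of visits to a closed set is at most its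
measure. -/
theorem limsup_density_le_measure [MetricSpace X] [MeasurableSpace X]
    [BorelSpace X] {u : ℕ → X} {ν : Measure X} [IsProbabilityMeasure ν]
    (hgen : ∀ φ : X → ℝ, Continuous φ →
      Tendsto (fun n : ℕ => (∑ i ∈ Finset.range n, φ (u i)) / (n : ℝ)) atTop (𝓝 (∫ x, φ x ∂ν)))
    {p : ℕ → Prop} {m : ℕ} {K : Set X} (hK : IsClosed K) (hpK : ∀ j, p j → m ≤ j → u j ∈ K) :
    ENNReal.ofReal
      (limsup (fun n : ℕ => (((Finset.range n).filter p).card : ℝ) / n) atTop) ≤ ν K := by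
  refine le_of_forall_gt fun r hr => ?_
  obtain ⟨U, hKU, hU, hUr⟩ := K.exists_isOpen_lt_of_lt r hr
  refine lt_of_le_of_lt ?_ hUr
  obtain ⟨f, hf0, hf1, hf⟩ := exists_continuous_zero_one_of_isClosed hU.isClosed_compl hK
    (disjoint_compl_left_iff_subset.2 hKU)
  refine ENNReal.ofReal_le_of_le_toReal ?_
  have hint : ∫ x, f x ∂ν ≤ (ν U).toReal := by
    rw [← measureReal_def, ← integral_indicator_one hU.measurableSet]
    refine integral_mono_of_nonneg (.of_forall fun x => (hf x).1)
      ((integrable_const (1 : ℝ)).indicator hU.measurableSet) (.of_forall fun x => ?_)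
    by_cases hx : x ∈ U
    · simpa [hx] using (hf x).2
    · simpa [hx] using (hf0 hx).le
  refine le_trans ?_ hint
  have hlim : Tendsto (fun n : ℕ => (∑ i ∈ Finset.range n, f (u i)) / (n : ℝ) + m / n) atTop
      (𝓝 (∫ x, f x ∂ν)) := by
    simpa using (hgen f f.continuous).add (tendsto_const_div_atTop_nhds_zero_nat (m : ℝ))
  rw [← hlim.limsup_eq]
  refine limsup_le_limsup (.of_forall fun n => ?_)
    (isCoboundedUnder_le_of_le atTop (x := 0) fun n => by positivity) hlim.isBoundedUnder_le
  change (((Finset.range n).filter p).card : ℝ) / n ≤ _ / (n : ℝ) + m / n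
  rw [← add_div]
  gcongr
  have hcard : ((Finset.range n).filter p).card ≤
      ((Finset.range n).filter fun j => p j ∧ m ≤ j).card + m := by
    calc _ ≤ (((Finset.range n).filter fun j => p j ∧ m ≤ j) ∪ Finset.range m).card := by
          refine Finset.card_le_card fun j => ?_
          simp only [Finset.mem_filter, Finset.mem_union, Finset.mem_range]
          rintro ⟨h1, h2⟩
          by_cases h3 : m ≤ j
          · exact .inl ⟨h1, h2, h3⟩
          · exact .inr (not_le.1 h3)
      _ ≤ _ := by simpa using Finset.card_union_le _ (Finset.range m)
  have hsum : (((Finset.range n).filter fun j => p j ∧ m ≤ j).card : ℝ) ≤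
      ∑ i ∈ Finset.range n, f (u i) := by
    rw [Finset.card_filter, Nat.cast_sum]
    refine Finset.sum_le_sum fun i _ => ?_
    split_ifs with h
    · simpa using (hf1 (hpK i h.1 h.2)).ge
    · simpa using (hf (u i)).1
  calc (((Finset.range n).filter p).card : ℝ)
      ≤ (((Finset.range n).filter fun j => p j ∧ m ≤ j).card : ℝ) + m := by exact_mod_cast hcard
    _ ≤ _ := by gcongr

theorem limsup_density_le_measure_block [MetricSpace X]
    [MeasurableSpace X] [BorelSpace X] {g : Equiv.Perm X} {x₀ : X} {φE φF : X → ℝ} {cE cF : ℝ}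
    {ν : Measure X} [IsProbabilityMeasure ν]
    (hgen : ∀ φ : X → ℝ, Continuous φ →
      Tendsto (fun n : ℕ => (∑ i ∈ Finset.range n, φ ((g ^ i) x₀)) / (n : ℝ))
        atTop (𝓝 (∫ x, φ x ∂ν))) (t : ℝ) :
    ENNReal.ofReal (limsup (fun n : ℕ =>
      (((Finset.range n).filter fun j => memH g x₀ φE φF cE cF t j).card : ℝ) / n) atTop) ≤
      ν (block g x₀ φE φF cE cF t) := by
  have hanti : Antitone fun m : ℕ =>
      closure ((fun j : ℕ => (g ^ j) x₀) '' {j | memH g x₀ φE φF cE cF t j ∧ m ≤ j}) :=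
    fun _ _ hab => closure_mono <| image_mono fun _ hj => ⟨hj.1, hab.trans hj.2⟩
  have hblock : block g x₀ φE φF cE cF t = ⋂ m : ℕ,
      closure ((fun j : ℕ => (g ^ j) x₀) '' {j | memH g x₀ φE φF cE cF t j ∧ m ≤ j}) := by
    refine Subset.antisymm (subset_iInter fun m => ?_)
      (subset_iInter₂ fun m _ => iInter_subset _ m)
    exact (biInter_subset_of_mem (Nat.le_add_left 1 m)).trans (hanti (Nat.le_succ m))
  rw [hblock, hanti.measure_iInter (fun _ => isClosed_closure.nullMeasurableSet)
    ⟨0, measure_ne_top _ _⟩]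
  exact le_iInf fun m => limsup_density_le_measure (m := m) hgen isClosed_closure
    fun j hj hm => subset_closure ⟨j, ⟨hj, hm⟩, rfl⟩

end ResonanceBlock

/-- Lemma 3.5: if `ν` is `g`-invariant and ergodic, `x₀` is `ν`-generic, and `H_{t₀}`
has positive upper density for some `t₀ ≥ 1`, then `ν(⋃_{t ≥ 1} Λ_t) = 1` and
`ν(Λ_t) → 1` as `t → ∞`. -/
theorem stmt_3 [MetricSpace X] [CompactSpace X] [MeasurableSpace X] [BorelSpace X]
    (g : Equiv.Perm X) (hg : Continuous ⇑g) (hg' : Continuous ⇑g.symm)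
    (x₀ : X) (φE φF : X → ℝ) (hφE : Continuous φE) (hφF : Continuous φF)
    (hφEpos : ∀ x, 0 < φE x) (hφFpos : ∀ x, 0 < φF x)
    (cE cF : ℝ) (hcE : 0 < cE) (hcF : 0 < cF)
    (ν : Measure X) [IsProbabilityMeasure ν] (herg : Ergodic (⇑g) ν)
    (hgen : ∀ φ : X → ℝ, Continuous φ →
      Tendsto (fun n : ℕ => (∑ i ∈ Finset.range n, φ ((g ^ i) x₀)) / (n : ℝ))
        atTop (𝓝 (∫ x, φ x ∂ν)))
    (hdens : ∃ t₀ : ℝ, 1 ≤ t₀ ∧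
      0 < limsup (fun n : ℕ =>
        (((Finset.range n).filter fun j => memH g x₀ φE φF cE cF t₀ j).card : ℝ) / n) atTop) :
    ν (blockUnion g x₀ φE φF cE cF) = 1 ∧
    Tendsto (fun t : ℝ => ν (block g x₀ φE φF cE cF t)) atTop (𝓝 1) := by
  obtain ⟨t₀, -, hpos⟩ := hdens
  have hmono : Monotone (block g x₀ φE φF cE cF) := block_mono hφEpos hcF
  have hmeas : MeasurableSet (⋃ t : ℝ, block g x₀ φE φF cE cF t) :=
    measurableSet_iUnion_of_monotone_of_isClosed hmono (isClosed_block g x₀ φE φF cE cF)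
  have hne : ν (⋃ t : ℝ, block g x₀ φE φF cE cF t) ≠ 0 :=
    ((ENNReal.ofReal_pos.2 hpos).trans_le ((limsup_density_le_measure_block hgen t₀).trans
      (measure_mono (subset_iUnion _ t₀)))).ne'
  obtain ⟨C, hC⟩ := exists_mapsTo_block hg x₀ hφE hφF hφEpos hφFpos hcE hcF
  have hsub : (⋃ t : ℝ, block g x₀ φE φF cE cF t) ⊆
      g ⁻¹' ⋃ t : ℝ, block g x₀ φE φF cE cF t :=
    iUnion_subset fun t x hx => mem_iUnion.2 ⟨C * t, hC t hx⟩
  have hone : ν (⋃ t : ℝ, block g x₀ φE φF cE cF t) = 1 := by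
    rcases herg.ae_empty_or_univ_of_ae_le_preimage hmeas.nullMeasurableSet
      hsub.eventuallyLE with h | h
    · exact absurd (ae_eq_empty.1 h) hne
    · rw [measure_congr h, measure_univ]
  refine ⟨by rw [blockUnion_eq_iUnion hφEpos hcF, hone], ?_⟩
  rw [← hone]
  exact tendsto_measure_iUnion_atTop hmono
end
end

section
/- For every x ∈ R and every integer k ≥ 1 the following four estimates hold: (1) ∏_{i=−k}^{−1} φ_E(gⁱ(x)) ≥ T(x)⁻¹ · c_E^k; (2) ∏_{i=0}^{k−1} φ_E(gⁱ(x)) ≥ T(x)⁻¹ · c_E^k; (3) ∏_{i=−k}^{−1} φ_F(gⁱ(x)) ≤ T(x) · c_F^k; (4) ∏_{i=0}^{k−1} φ_F(gⁱ(x)) ≤ T(x) · c_F^k. (Lemma 3.9 of the paper, stated for the abstract resonance-block construction.) -/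
open Set Filter Topology MeasureTheory
open scoped Classical

noncomputable section

variable {X : Type*}

/-- Products over the forward orbit of `gⁿ x₀` are products over an interval of times. -/
theorem prod_range_orbit {M : Type*} [CommMonoid M] (g : Equiv.Perm X) (x₀ : X) (φ : X → M)
    (n k : ℕ) :
    ∏ i ∈ Finset.range k, φ ((g ^ i) ((g ^ n) x₀)) =
      ∏ i ∈ Finset.Ico n (n + k), φ ((g ^ i) x₀) := by
  rw [Finset.prod_Ico_eq_prod_range, Nat.add_sub_cancel_left]
  refine Finset.prod_congr rfl fun i _ => ?_
  rw [← Equiv.Perm.mul_apply, ← pow_add, add_comm]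

/-- Products over the backward orbit of `gⁿ x₀` are products over an interval of times. -/
theorem prod_Icc_orbit_neg {M : Type*} [CommMonoid M] (g : Equiv.Perm X) (x₀ : X) (φ : X → M)
    {n k : ℕ} (hk : k ≤ n) :
    ∏ i ∈ Finset.Icc 1 k, φ ((g ^ (-(i : ℤ))) ((g ^ n) x₀)) =
      ∏ i ∈ Finset.Ico (n - k) n, φ ((g ^ i) x₀) := by
  refine Finset.prod_nbij' (fun i => n - i) (fun i => n - i) ?_ ?_ ?_ ?_ ?_
  · intro i hi
    simp only [Finset.mem_Icc, Finset.mem_Ico] at hi ⊢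
    omega
  · intro i hi
    simp only [Finset.mem_Icc, Finset.mem_Ico] at hi ⊢
    omega
  · intro i hi
    simp only [Finset.mem_Icc] at hi
    omega
  · intro i hi
    simp only [Finset.mem_Ico] at hi
    omega
  · intro i hi
    simp only [Finset.mem_Icc] at hi
    rw [← Equiv.Perm.mul_apply, ← zpow_natCast g n, ← zpow_add, ← zpow_natCast g (n - i),
      Nat.cast_sub (by omega), neg_add_eq_sub]

theorem continuous_perm_pow [TopologicalSpace X] {g : Equiv.Perm X} (hg : Continuous ⇑g)
    (n : ℕ) : Continuous ⇑(g ^ n) := by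
  rw [Equiv.Perm.coe_pow]
  exact hg.iterate n

theorem continuous_perm_zpow_neg [TopologicalSpace X] {g : Equiv.Perm X}
    (hg : Continuous ⇑g.symm) (n : ℕ) : Continuous ⇑(g ^ (-(n : ℤ))) := by
  rw [zpow_neg, zpow_natCast, ← inv_pow]
  exact continuous_perm_pow hg n

/-- A closed set containing `gʲ x₀` for all large `j ∈ H_t` contains the block `Λ_t`. -/
theorem block_subset_of_isClosed [TopologicalSpace X] {g : Equiv.Perm X} {x₀ : X}
    {φE φF : X → ℝ} {cE cF t : ℝ} {C : Set X} (hC : IsClosed C) {m : ℕ} (hm : 1 ≤ m)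
    (h : ∀ j, memH g x₀ φE φF cE cF t j → m ≤ j → (g ^ j) x₀ ∈ C) :
    block g x₀ φE φF cE cF t ⊆ C := by
  intro x hx
  refine closure_minimal ?_ hC (mem_iInter₂.1 hx m hm)
  rintro _ ⟨j, ⟨hj, hmj⟩, rfl⟩
  exact h j hj hmj

/-- A bound valid for every admissible parameter `t` is valid for `T(x)`. -/
theorem le_Tfun_mul [TopologicalSpace X] {g : Equiv.Perm X} {x₀ : X} {φE φF : X → ℝ}
    {cE cF : ℝ} {x : X} (hx : x ∈ blockUnion g x₀ φE φF cE cF) {a b : ℝ} (hb : 0 < b)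
    (h : ∀ t, x ∈ block g x₀ φE φF cE cF t → a ≤ t * b) :
    a ≤ Tfun g x₀ φE φF cE cF x * b := by
  obtain ⟨t, ht, hxt⟩ := mem_iUnion₂.1 hx
  rw [← div_le_iff₀ hb]
  exact le_csInf ⟨t, ht, hxt⟩ fun s hs => (div_le_iff₀ hb).2 (h s hs.2)

theorem Tfun_pos [TopologicalSpace X] {g : Equiv.Perm X} {x₀ : X} {φE φF : X → ℝ}
    {cE cF : ℝ} {x : X} (hx : x ∈ blockUnion g x₀ φE φF cE cF) :
    0 < Tfun g x₀ φE φF cE cF x := by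
  obtain ⟨t, ht, hxt⟩ := mem_iUnion₂.1 hx
  exact one_pos.trans_le (le_csInf ⟨t, ht, hxt⟩ fun s hs => hs.1)

/-- Lemma 3.9: for every `x ∈ R` and every `k ≥ 1`, the backward and forward products of
`φE` along the orbit of `x` are bounded below by `T(x)⁻¹·c_E^k`, and those of `φF` are
bounded above by `T(x)·c_F^k`. -/
theorem stmt_6 [MetricSpace X] [CompactSpace X]
    (g : Equiv.Perm X) (hg : Continuous ⇑g) (hg' : Continuous ⇑g.symm)
    (x₀ : X) (φE φF : X → ℝ) (hφE : Continuous φE) (hφF : Continuous φF)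
    (hφEpos : ∀ x, 0 < φE x) (hφFpos : ∀ x, 0 < φF x)
    (cE cF : ℝ) (hcE : 0 < cE) (hcF : 0 < cF) :
    ∀ x ∈ blockUnion g x₀ φE φF cE cF, ∀ k : ℕ, 1 ≤ k →
      (Tfun g x₀ φE φF cE cF x)⁻¹ * cE ^ k
          ≤ ∏ i ∈ Finset.Icc 1 k, φE ((g ^ (-(i : ℤ))) x) ∧
      (Tfun g x₀ φE φF cE cF x)⁻¹ * cE ^ k
          ≤ ∏ i ∈ Finset.range k, φE ((g ^ i) x) ∧
      (∏ i ∈ Finset.Icc 1 k, φF ((g ^ (-(i : ℤ))) x))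
          ≤ Tfun g x₀ φE φF cE cF x * cF ^ k ∧
      (∏ i ∈ Finset.range k, φF ((g ^ i) x))
          ≤ Tfun g x₀ φE φF cE cF x * cF ^ k := by
  intro x hx k hk
  have hforward {φ : X → ℝ} (hφ : Continuous φ) :
      Continuous fun y => ∏ i ∈ Finset.range k, φ ((g ^ i) y) :=
    continuous_finsetProd _ fun i _ => hφ.comp (continuous_perm_pow hg i)
  have hbackward {φ : X → ℝ} (hφ : Continuous φ) :
      Continuous fun y => ∏ i ∈ Finset.Icc 1 k, φ ((g ^ (-(i : ℤ))) y) :=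
    continuous_finsetProd _ fun i _ => hφ.comp (continuous_perm_zpow_neg hg' i)
  refine ⟨?_, ?_, ?_, ?_⟩
  · rw [inv_mul_le_iff₀ (Tfun_pos hx)]
    refine le_Tfun_mul hx (Finset.prod_pos fun i _ => hφEpos _) fun t ht => ?_
    refine block_subset_of_isClosed
      (isClosed_le continuous_const ((hbackward hφE).const_mul t)) hk ?_ ht
    intro j hj hkj
    rw [mem_ofPred_eq, prod_Icc_orbit_neg g x₀ φE hkj]
    exact (hj.1 k hkj).2
  · rw [inv_mul_le_iff₀ (Tfun_pos hx)]
    refine le_Tfun_mul hx (Finset.prod_pos fun i _ => hφEpos _) fun t ht => ?_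
    refine block_subset_of_isClosed
      (isClosed_le continuous_const ((hforward hφE).const_mul t)) hk ?_ ht
    intro j hj _
    rw [mem_ofPred_eq, prod_range_orbit]
    exact (hj.2 k).2
  · refine le_Tfun_mul hx (pow_pos hcF k) fun t ht => ?_
    refine block_subset_of_isClosed (isClosed_le (hbackward hφF) continuous_const) hk ?_ ht
    intro j hj hkj
    rw [mem_ofPred_eq, prod_Icc_orbit_neg g x₀ φF hkj]
    exact (hj.1 k hkj).1
  · refine le_Tfun_mul hx (pow_pos hcF k) fun t ht => ?_
    refine block_subset_of_isClosed (isClosed_le (hforward hφF) continuous_const) hk ?_ ht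
    intro j hj _
    rw [mem_ofPred_eq, prod_range_orbit]
    exact (hj.2 k).1
end
end

section
/- Let X be a compact metric space, f : X → X continuous, and μ an f-invariant Borel probability measure. Let γ₁ < γ₂ be real numbers and let Φ = {φ_n}_{n ≥ 1} be a sequence of continuous functions φ_n : X → ℝ satisfying the subadditivity relation φ_{n+m}(x) ≤ φ_n(x) + φ_m(fⁿ(x)) for all n, m ≥ 1 and all x ∈ X. Assume that for μ-almost every x the limit lim_{n→∞} φ_n(x)/n exists and is at most γ₁. For N ≥ 1 and x ∈ X define T_N(Φ, x, γ₂) = { n ∈ ℕ : (1/(kN)) ∑_{i=n−k}^{n−1} φ_N(f^{iN}(x)) ≤ γ₂ for all 1 ≤ k ≤ n, and (1/(jN)) ∑_{i=n}^{n+j−1} φ_N(f^{iN}(x)) ≤ γ₂ for all j ≥ 1 }. Then for every θ ∈ (0,1) there exists N₀ ≥ 1 such that for all N ≥ N₀, μ({x ∈ X : the lower density of T_N(Φ, x, γ₂) is > θ}) > θ. (Lemma 3.12 of the paper.) -/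
open Set Filter Topology MeasureTheory
open scoped Classical

noncomputable section

/-- Rising sun covering estimate: the times in `[s, L)` from which some average of `u` over a
window inside `[s, L)` exceeds `c`. -/
lemma card_forward_le_sum {u : ℕ → ℝ} (hu : ∀ i, 0 ≤ u i) {c : ℝ} (s L : ℕ) :
    (((Finset.Ico s L).filter fun m =>
      ∃ j, 1 ≤ j ∧ m + j ≤ L ∧ c * j < ∑ i ∈ Finset.Ico m (m + j), u i).card : ℝ) * c ≤
      ∑ i ∈ Finset.Ico s L, u i := by
  by_cases hc : c < 0
  · exact (mul_nonpos_of_nonneg_of_nonpos (by positivity) hc.le).trans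
      (Finset.sum_nonneg fun i _ => hu i)
  push Not at hc
  induction h : L - s using Nat.strong_induction_on generalizing s with
  | _ d ih =>
    rcases Nat.lt_or_ge s L with hsL | hsL
    swap
    · simp [Finset.Ico_eq_empty_of_le hsL]
    by_cases hs : ∃ j, 1 ≤ j ∧ s + j ≤ L ∧ c * j < ∑ i ∈ Finset.Ico s (s + j), u i
    · obtain ⟨j, hj1, hjL, hj⟩ := hs
      have h1 := ih (L - (s + j)) (by omega) (s + j) rfl
      rw [← Finset.sum_Ico_consecutive u (Nat.le_add_right s j) hjL,
        ← Finset.Ico_union_Ico_eq_Ico (Nat.le_add_right s j) hjL, Finset.filter_union]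
      refine le_trans (mul_le_mul_of_nonneg_right
        (Nat.cast_le.mpr (Finset.card_union_le _ _)) hc) ?_
      have h2 := Finset.card_filter_le (Finset.Ico s (s + j)) fun m =>
        ∃ j, 1 ≤ j ∧ m + j ≤ L ∧ c * j < ∑ i ∈ Finset.Ico m (m + j), u i
      rw [Nat.card_Ico, Nat.add_sub_cancel_left] at h2
      have h3 := mul_le_mul_of_nonneg_right ((Nat.cast_le (α := ℝ)).mpr h2) hc
      push_cast at h3 ⊢
      linarith
    · have h1 := ih (L - (s + 1)) (by omega) (s + 1) rfl
      rw [← Finset.insert_Ico_add_one_left_eq_Ico hsL, Finset.filter_insert, if_neg hs,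
        Finset.sum_insert (by simp)]
      linarith [hu s]

/-- Rising sun covering estimate: the times `m ≤ n` such that some average of `u` over a window
ending at `m` exceeds `c`. -/
lemma card_backward_le_sum {u : ℕ → ℝ} (hu : ∀ i, 0 ≤ u i) {c : ℝ} (hc : 0 ≤ c) (n : ℕ) :
    (((Finset.range (n + 1)).filter fun m =>
      ∃ k, 1 ≤ k ∧ k ≤ m ∧ c * k < ∑ i ∈ Finset.Ico (m - k) m, u i).card : ℝ) * c ≤
      ∑ i ∈ Finset.range n, u i := by
  induction n using Nat.strong_induction_on with
  | _ n ih =>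
    by_cases hn : ∃ k, 1 ≤ k ∧ k ≤ n ∧ c * k < ∑ i ∈ Finset.Ico (n - k) n, u i
    · obtain ⟨k, hk1, hkn, hk⟩ := hn
      have h1 := ih (n - k) (by omega)
      rw [← Finset.sum_range_add_sum_Ico u (Nat.sub_le n k), Finset.range_eq_Ico,
        ← Finset.Ico_union_Ico_eq_Ico (Nat.zero_le (n - k + 1)) (by omega : n - k + 1 ≤ n + 1),
        Finset.filter_union, ← Finset.range_eq_Ico]
      refine le_trans (mul_le_mul_of_nonneg_right
        (Nat.cast_le.mpr (Finset.card_union_le _ _)) hc) ?_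
      have h2 := Finset.card_filter_le (Finset.Ico (n - k + 1) (n + 1)) fun m =>
        ∃ k, 1 ≤ k ∧ k ≤ m ∧ c * k < ∑ i ∈ Finset.Ico (m - k) m, u i
      rw [Nat.card_Ico, (by omega : n + 1 - (n - k + 1) = k)] at h2
      have h3 := mul_le_mul_of_nonneg_right ((Nat.cast_le (α := ℝ)).mpr h2) hc
      push_cast at h3 ⊢
      linarith
    · rw [Finset.range_add_one, Finset.filter_insert, if_neg hn]
      rcases n with _ | n
      · simp
      · rw [Finset.sum_range_succ]
        linarith [ih n (by omega), hu n]

/-- If all initial averages of `u ≥ 0` are at most `η`, then most times have all their forward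
and backward averages bounded by `c`. -/
lemma le_card_filter_of_sum_le {u : ℕ → ℝ} (hu : ∀ i, 0 ≤ u i) {c η : ℝ} (hc : 0 < c)
    (hη : η ≤ c / 2) (hsum : ∀ n : ℕ, ∑ i ∈ Finset.range n, u i ≤ η * n)
    {P : ℕ → Prop} [DecidablePred P]
    (hP : ∀ m, (∀ k, 1 ≤ k → k ≤ m → ∑ i ∈ Finset.Ico (m - k) m, u i ≤ c * k) →
      (∀ j, 1 ≤ j → ∑ i ∈ Finset.Ico m (m + j), u i ≤ c * j) → P m) (n : ℕ) :
    (1 - 3 * η / c) * n ≤ ((Finset.range n).filter P).card := by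
  set A := (Finset.range (n + 1)).filter fun m =>
    ∃ k, 1 ≤ k ∧ k ≤ m ∧ c * k < ∑ i ∈ Finset.Ico (m - k) m, u i
  set B := (Finset.Ico 0 (2 * n)).filter fun m =>
    ∃ j, 1 ≤ j ∧ m + j ≤ 2 * n ∧ c * j < ∑ i ∈ Finset.Ico m (m + j), u i
  have hA : (A.card : ℝ) * c ≤ η * n := (card_backward_le_sum hu hc.le n).trans (hsum n)
  have hB : (B.card : ℝ) * c ≤ η * (2 * n : ℕ) :=
    (card_forward_le_sum hu 0 (2 * n)).trans (by rw [← Finset.range_eq_Ico]; exact hsum _)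
  have hcover : Finset.range n ⊆ (Finset.range n).filter P ∪ (A ∪ B) := by
    intro m hm
    have hmn := Finset.mem_range.mp hm
    by_contra hnot
    simp only [Finset.mem_union, not_or, Finset.mem_filter, hm, true_and, A, B,
      Finset.mem_range, Finset.mem_Ico, not_and, not_exists, not_lt] at hnot
    obtain ⟨h1, h2, h3⟩ := hnot
    refine h1 (hP m (h2 (by omega)) fun j hj => ?_)
    by_cases hjn : m + j ≤ 2 * n
    · exact h3 ⟨by omega, by omega⟩ j hj hjn
    · have h4 : ∑ i ∈ Finset.Ico m (m + j), u i ≤ ∑ i ∈ Finset.range (m + j), u i :=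
        Finset.sum_le_sum_of_subset_of_nonneg
          (fun i hi => Finset.mem_range.mpr (Finset.mem_Ico.mp hi).2) fun i _ _ => hu i
      have h5 : (m : ℝ) ≤ j := by exact_mod_cast (by omega : m ≤ j)
      have h6 := hsum (m + j)
      push_cast at h6
      have h7 : η * (m + j) ≤ c / 2 * (m + j) := by gcongr
      nlinarith
  have hcard := (Finset.card_le_card hcover).trans
    ((Finset.card_union_le _ _).trans (Nat.add_le_add_left (Finset.card_union_le _ _) _))
  rw [Finset.card_range] at hcard
  have hcard' : (n : ℝ) ≤ ((Finset.range n).filter P).card + (A.card + B.card) := by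
    exact_mod_cast hcard
  have hAB : (A.card + B.card : ℝ) ≤ 3 * η / c * n := by
    rw [div_mul_eq_mul_div, le_div_iff₀ hc]
    push_cast at hB
    linarith
  linarith

section MaximalInequality

variable {X : Type*} [MeasurableSpace X] {μ : Measure X} [IsFiniteMeasure μ] {g : X → X}
  {b : X → ℝ}

lemma measurableSet_exists_le_lt_sum (hg : Measurable g) (hb : Measurable b) (η : ℝ) (M : ℕ) :
    MeasurableSet
      {x | ∃ j : ℕ, 1 ≤ j ∧ j ≤ M ∧ η * j < ∑ i ∈ Finset.range j, b (g^[i] x)} := by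
  have h : ∀ j : ℕ, Measurable fun x => ∑ i ∈ Finset.range j, b (g^[i] x) := fun j =>
    Finset.measurable_sum _ fun i _ => hb.comp (hg.iterate i)
  simp only [ofPred_exists]
  refine .iUnion fun j => ?_
  exact (MeasurableSet.const _).inter ((MeasurableSet.const _).inter
    (measurableSet_lt measurable_const (h j)))

/-- Maximal ergodic inequality with bounded window length. -/
lemma mul_measureReal_exists_le_lt_sum_le (hg : MeasurePreserving g μ μ) (hb : Measurable b)
    (hb0 : ∀ x, 0 ≤ b x) (hbi : Integrable b μ) (η : ℝ) (M : ℕ) :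
    μ.real {x | ∃ j : ℕ, 1 ≤ j ∧ j ≤ M ∧ η * j < ∑ i ∈ Finset.range j, b (g^[i] x)} * η ≤
      ∫ x, b x ∂μ := by
  set E := {x | ∃ j : ℕ, 1 ≤ j ∧ j ≤ M ∧ η * j < ∑ i ∈ Finset.range j, b (g^[i] x)} with hE_def
  have hE : MeasurableSet E := measurableSet_exists_le_lt_sum hg.measurable hb η M
  have hI0 : 0 ≤ ∫ x, b x ∂μ := integral_nonneg hb0
  rcases lt_or_ge η 0 with hη | hη
  · exact (mul_nonpos_of_nonneg_of_nonpos (by positivity) hη.le).trans hI0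
  have hbi' : ∀ i, Integrable (fun x => b (g^[i] x)) μ := fun i =>
    (hg.iterate i).integrable_comp_of_integrable hbi
  have hint : ∀ i, ∫ x, b (g^[i] x) ∂μ = ∫ x, b x ∂μ := fun i => by
    have hgi := hg.iterate i
    conv_rhs => rw [← hgi.map_eq]
    rw [integral_map hgi.measurable.aemeasurable hb.aestronglyMeasurable]
  have hEi : ∀ m, MeasurableSet (g^[m] ⁻¹' E) := fun m => (hg.iterate m).measurable hE
  have hind : ∀ m, Integrable ((g^[m] ⁻¹' E).indicator (1 : X → ℝ)) μ := fun m =>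
    (integrable_const (1 : ℝ)).indicator (hEi m)
  have key : ∀ n : ℕ, n * (μ.real E * η) ≤ (n + M : ℕ) * ∫ x, b x ∂μ := by
    intro n
    have hpt : ∀ x, (∑ m ∈ Finset.range n, (g^[m] ⁻¹' E).indicator (1 : X → ℝ) x) * η ≤
        ∑ i ∈ Finset.range (n + M), b (g^[i] x) := by
      intro x
      have h1 := card_forward_le_sum (u := fun i => b (g^[i] x)) (fun i => hb0 _) (c := η)
        0 (n + M)
      rw [← Finset.range_eq_Ico] at h1
      refine le_trans (mul_le_mul_of_nonneg_right ?_ hη) h1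
      simp only [indicator_apply, Pi.one_apply, Finset.sum_boole]
      refine Nat.cast_le.mpr (Finset.card_le_card fun m hm => ?_)
      simp only [Finset.mem_filter, Finset.mem_range, mem_preimage, hE_def, mem_ofPred_eq] at hm ⊢
      obtain ⟨hm, j, hj1, hjM, hj⟩ := hm
      refine ⟨by omega, j, hj1, by omega, ?_⟩
      rw [Finset.sum_Ico_eq_sum_range, Nat.add_sub_cancel_left]
      simpa only [add_comm m, Function.iterate_add_apply] using hj
    have h2 := integral_mono ((integrable_finsetSum _ fun m _ => hind m).mul_const η)
      (integrable_finsetSum _ fun i _ => hbi' i) hpt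
    rw [integral_mul_const, integral_finsetSum _ fun m _ => hind m,
      integral_finsetSum _ fun i _ => hbi' i] at h2
    simp only [hint, integral_indicator_one (hEi _),
      (hg.iterate _).measureReal_preimage hE.nullMeasurableSet, Finset.sum_const,
      Finset.card_range, nsmul_eq_mul] at h2
    linarith
  by_contra! hlt
  obtain ⟨n, hn⟩ := exists_nat_gt ((M * ∫ x, b x ∂μ) / (μ.real E * η - ∫ x, b x ∂μ))
  rw [div_lt_iff₀ (sub_pos.mpr hlt)] at hn
  have := key n
  push_cast at this
  linarith

/-- Maximal ergodic inequality. -/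
lemma mul_measureReal_exists_lt_sum_le (hg : MeasurePreserving g μ μ) (hb : Measurable b)
    (hb0 : ∀ x, 0 ≤ b x) (hbi : Integrable b μ) (η : ℝ) :
    μ.real {x | ∃ j : ℕ, 1 ≤ j ∧ η * j < ∑ i ∈ Finset.range j, b (g^[i] x)} * η ≤
      ∫ x, b x ∂μ := by
  have hU : {x | ∃ j : ℕ, 1 ≤ j ∧ η * j < ∑ i ∈ Finset.range j, b (g^[i] x)} =
      ⋃ M : ℕ, {x | ∃ j : ℕ, 1 ≤ j ∧ j ≤ M ∧ η * j < ∑ i ∈ Finset.range j, b (g^[i] x)} := by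
    ext x
    simp only [mem_ofPred_eq, mem_iUnion]
    exact ⟨fun ⟨j, h1, h2⟩ => ⟨j, j, h1, le_rfl, h2⟩, fun ⟨_, j, h1, _, h2⟩ => ⟨j, h1, h2⟩⟩
  have hmono : Monotone fun M : ℕ =>
      {x | ∃ j : ℕ, 1 ≤ j ∧ j ≤ M ∧ η * j < ∑ i ∈ Finset.range j, b (g^[i] x)} :=
    fun M M' h x ⟨j, h1, h2, h3⟩ => ⟨j, h1, h2.trans h, h3⟩
  have ht := (ENNReal.tendsto_toReal (measure_ne_top μ _)).comp
    (tendsto_measure_iUnion_atTop (μ := μ) hmono)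
  rw [hU]
  exact le_of_tendsto (ht.mul_const η)
    (Eventually.of_forall (mul_measureReal_exists_le_lt_sum_le hg hb hb0 hbi η))

end MaximalInequality

/-- The mean excess of `φ n / n` over a level above its almost sure limit tends to zero. -/
lemma tendsto_integral_max_div_sub {X : Type*} [MetricSpace X] [CompactSpace X]
    [MeasurableSpace X] [BorelSpace X] {f : X → X} {μ : Measure X} [IsFiniteMeasure μ]
    {γ γ' : ℝ} (hγ : γ < γ') {φ : ℕ → X → ℝ} (hφc : ∀ n, 1 ≤ n → Continuous (φ n))
    (hsub : ∀ n m : ℕ, 1 ≤ n → 1 ≤ m → ∀ x : X, φ (n + m) x ≤ φ n x + φ m (f^[n] x))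
    (hlim : ∀ᵐ x ∂μ, ∃ L : ℝ, L ≤ γ ∧ Tendsto (fun n : ℕ => φ n x / n) atTop (𝓝 L)) :
    Tendsto (fun n : ℕ => ∫ x, max (φ n x / n - γ') 0 ∂μ) atTop (𝓝 0) := by
  obtain ⟨C, hC⟩ := (isCompact_range (hφc 1 le_rfl)).bddAbove
  have hC1 : ∀ x, φ 1 x ≤ C := fun x => hC (mem_range_self x)
  have hφC : ∀ n : ℕ, 1 ≤ n → ∀ x, φ n x ≤ C * n := by
    intro n hn
    induction n, hn using Nat.le_induction with
    | base => simpa using hC1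
    | succ n hn ih =>
      intro x
      have := hsub n 1 hn le_rfl x
      push_cast
      linarith [ih x, hC1 (f^[n] x)]
  rw [← tendsto_add_atTop_iff_nat 1,
    show 𝓝 (0 : ℝ) = 𝓝 (∫ _ : X, (0 : ℝ) ∂μ) by rw [integral_zero]]
  refine tendsto_integral_of_dominated_convergence (fun _ => max (C - γ') 0)
    (fun n => ?_) (integrable_const _) (fun n => ?_) ?_
  · exact ((((hφc (n + 1) (by omega)).div_const _).sub continuous_const).max
      continuous_const).aestronglyMeasurable
  · refine Eventually.of_forall fun x => ?_
    rw [Real.norm_of_nonneg (le_max_right _ _)]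
    have : φ (n + 1) x / (n + 1 : ℕ) ≤ C :=
      (div_le_iff₀ (by positivity)).mpr (hφC (n + 1) (by omega) x)
    gcongr
  · filter_upwards [hlim] with x ⟨L, hL, hx⟩
    refine tendsto_const_nhds.congr' ?_
    have hx' := (tendsto_add_atTop_iff_nat 1).mpr hx
    filter_upwards [hx'.eventually_lt_const (hL.trans_lt hγ)] with n hn
    exact (max_eq_right (by linarith)).symm

/-- Lemma 3.12: for a subadditive sequence of continuous functions whose a.e. asymptotic
average is at most `γ₁ < γ₂`, for every `θ ∈ (0,1)` there is `N₀` such that for all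
`N ≥ N₀` the set of points whose set of "resonance times" `T_N(Φ,x,γ₂)` has lower
density `> θ` has `μ`-measure `> θ`. -/
theorem stmt_8 {X : Type*} [MetricSpace X] [CompactSpace X] [MeasurableSpace X] [BorelSpace X]
    (f : X → X) (hf : Continuous f)
    (μ : Measure X) [IsProbabilityMeasure μ] (hμ : MeasurePreserving f μ μ)
    (γ₁ γ₂ : ℝ) (hγ : γ₁ < γ₂)
    (φ : ℕ → X → ℝ) (hφc : ∀ n, 1 ≤ n → Continuous (φ n))
    (hsub : ∀ n m : ℕ, 1 ≤ n → 1 ≤ m → ∀ x : X, φ (n + m) x ≤ φ n x + φ m (f^[n] x))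
    (hlim : ∀ᵐ x ∂μ, ∃ L : ℝ, L ≤ γ₁ ∧ Tendsto (fun n : ℕ => φ n x / n) atTop (𝓝 L)) :
    ∀ θ : ℝ, 0 < θ → θ < 1 → ∃ N₀ : ℕ, 1 ≤ N₀ ∧ ∀ N : ℕ, N₀ ≤ N →
      ENNReal.ofReal θ < μ {x : X |
        θ < liminf (fun n : ℕ =>
          (((Finset.range n).filter fun m : ℕ =>
              (∀ k : ℕ, 1 ≤ k → k ≤ m →
                (∑ i ∈ Finset.Ico (m - k) m, φ N (f^[i * N] x)) ≤ γ₂ * ((k * N : ℕ) : ℝ)) ∧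
              (∀ j : ℕ, 1 ≤ j →
                (∑ i ∈ Finset.Ico m (m + j), φ N (f^[i * N] x)) ≤ γ₂ * ((j * N : ℕ) : ℝ))).card : ℝ)
            / n) atTop} := by
  intro θ hθ0 hθ1
  set c := (γ₂ - γ₁) / 2 with hc_def
  have hc : 0 < c := by linarith
  set η := c * (1 - θ) / 6 with hη_def
  have hη : 0 < η := by have := sub_pos.mpr hθ1; positivity
  have hηc : η ≤ c / 2 := by nlinarith
  have hθη : θ < 1 - 3 * η / c := by
    rw [hη_def, (by field_simp; ring : 3 * (c * (1 - θ) / 6) / c = (1 - θ) / 2)]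
    linarith
  have hT := tendsto_integral_max_div_sub (μ := μ) (by linarith : γ₁ < γ₁ + c) hφc hsub hlim
  obtain ⟨N₀, hN₀⟩ := eventually_atTop.mp
    (hT.eventually_lt_const (mul_pos hη (sub_pos.mpr hθ1)))
  refine ⟨max N₀ 1, le_max_right _ _, fun N hN => ?_⟩
  have hN1 : 1 ≤ N := (le_max_right _ _).trans hN
  have hNpos : (0 : ℝ) < N := by exact_mod_cast hN1
  set b : X → ℝ := fun x => max (φ N x / N - (γ₁ + c)) 0 with hb_def
  have hbc : Continuous b :=
    (((hφc N hN1).div_const _).sub continuous_const).max continuous_const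
  have hb0 : ∀ x, 0 ≤ b x := fun x => le_max_right _ _
  have hφb : ∀ x, φ N x ≤ N * (b x + (γ₁ + c)) := fun x => by
    have h : φ N x / N - (γ₁ + c) ≤ b x := le_max_left _ _
    rw [sub_le_iff_le_add, div_le_iff₀ hNpos] at h
    linarith
  set E := {x | ∃ j : ℕ, 1 ≤ j ∧ η * j < ∑ i ∈ Finset.range j, b ((f^[N])^[i] x)} with hE_def
  have hE : MeasurableSet E := by
    have h : ∀ j : ℕ, Measurable fun x => ∑ i ∈ Finset.range j, b ((f^[N])^[i] x) := fun j =>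
      Finset.measurable_sum _ fun i _ =>
        hbc.measurable.comp ((hf.iterate N).iterate i).measurable
    simp only [hE_def, ofPred_exists]
    exact .iUnion fun j => (MeasurableSet.const _).inter
      (measurableSet_lt measurable_const (h j))
  have hμE : μ.real E < 1 - θ := by
    have h1 := mul_measureReal_exists_lt_sum_le (hμ.iterate N) hbc.measurable hb0
      (hbc.integrable_of_hasCompactSupport (HasCompactSupport.of_compactSpace b)) η
    have h2 := h1.trans_lt (hN₀ N ((le_max_left _ _).trans hN))
    rw [mul_comm] at h2
    exact lt_of_mul_lt_mul_left h2 hη.le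
  have hμEc : ENNReal.ofReal θ < μ Eᶜ := by
    rw [ENNReal.ofReal_lt_iff_lt_toReal hθ0.le (measure_ne_top _ _)]
    change θ < μ.real Eᶜ
    rw [probReal_compl_eq_one_sub hE]
    linarith
  refine hμEc.trans_le (measure_mono fun x hx => ?_)
  simp only [hE_def, mem_compl_iff, mem_ofPred_eq, not_exists, not_and, not_lt] at hx
  refine hθη.trans_le (le_liminf_of_le ?_ ?_)
  · refine isCoboundedUnder_ge_of_le _ (x := 1) fun n => div_le_one_of_le₀ ?_ n.cast_nonneg
    exact_mod_cast (Finset.card_filter_le _ _).trans_eq (Finset.card_range n)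
  have hsumle : ∀ s : Finset ℕ, ∑ i ∈ s, b ((f^[N])^[i] x) ≤ c * s.card →
      ∑ i ∈ s, φ N (f^[i * N] x) ≤ γ₂ * ((s.card * N : ℕ) : ℝ) := by
    intro s hs
    calc ∑ i ∈ s, φ N (f^[i * N] x) ≤ ∑ i ∈ s, N * (b ((f^[N])^[i] x) + (γ₁ + c)) := by
          refine Finset.sum_le_sum fun i _ => ?_
          rw [mul_comm i, Function.iterate_mul]
          exact hφb _
      _ = N * (∑ i ∈ s, b ((f^[N])^[i] x) + s.card * (γ₁ + c)) := by
          rw [← Finset.mul_sum, Finset.sum_add_distrib, Finset.sum_const, nsmul_eq_mul]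
      _ ≤ N * (c * s.card + s.card * (γ₁ + c)) := by gcongr
      _ = γ₂ * ((s.card * N : ℕ) : ℝ) := by
          push_cast
          rw [hc_def]
          ring
  filter_upwards [eventually_gt_atTop 0] with n hn
  rw [le_div_iff₀ (by exact_mod_cast hn)]
  refine le_card_filter_of_sum_le (u := fun i => b ((f^[N])^[i] x)) (fun i => hb0 _) hc hηc
    (fun n => ?_) (fun m hk hj => ⟨fun k hk1 hkm => ?_, fun j hj1 => ?_⟩) n
  · rcases Nat.eq_zero_or_pos n with rfl | hn
    · simp
    · exact hx n hn
  · have hcard : (Finset.Ico (m - k) m).card = k := by rw [Nat.card_Ico]; omega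
    have := hsumle (Finset.Ico (m - k) m) (by rw [hcard]; exact hk k hk1 hkm)
    rwa [hcard] at this
  · have hcard : (Finset.Ico m (m + j)).card = j := by rw [Nat.card_Ico]; omega
    have := hsumle (Finset.Ico m (m + j)) (by rw [hcard]; exact hj j hj1)
    rwa [hcard] at this
end
end

section
/- Let (X, 𝔅, μ) be a probability space, f : X → X a measure-preserving map, θ ∈ (0,1), and H ∈ 𝔅 a set with μ(H) > 1 − ((1−θ)/2)². Then μ({ x ∈ X : liminf_{n→∞} (1/n) · #{0 ≤ i < n : fⁱ(x) ∈ H} > (1+θ)/2 }) > (1+θ)/2. (This is the intermediate claim established in the proof of Lemma 3.12 of the paper, via the Birkhoff ergodic theorem applied to the indicator of H together with a Markov-type estimate.) -/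
open Set Filter Topology MeasureTheory
open scoped Classical

noncomputable section

/-- The maximum of the Birkhoff sums of `F` along `f` of lengths `0, …, n`. -/
def maxBirkhoffSum {X : Type*} (f : X → X) (F : X → ℝ) : ℕ → X → ℝ
  | 0, _ => 0
  | n + 1, x => max 0 (F x + maxBirkhoffSum f F n (f x))

section MaxBirkhoffSum

variable {X : Type*} (f : X → X) (F : X → ℝ)

lemma maxBirkhoffSum_nonneg (n : ℕ) (x : X) : 0 ≤ maxBirkhoffSum f F n x := by
  cases n with
  | zero => exact le_rfl
  | succ n => exact le_max_left _ _

lemma maxBirkhoffSum_le_succ (n : ℕ) (x : X) :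
    maxBirkhoffSum f F n x ≤ maxBirkhoffSum f F (n + 1) x := by
  induction n generalizing x with
  | zero => exact maxBirkhoffSum_nonneg f F 1 x
  | succ n ih => exact max_le_max le_rfl (add_le_add le_rfl (ih (f x)))

lemma birkhoffSum_le_maxBirkhoffSum (n : ℕ) (x : X) :
    birkhoffSum f F n x ≤ maxBirkhoffSum f F n x := by
  induction n generalizing x with
  | zero => simp [maxBirkhoffSum]
  | succ n ih =>
    rw [birkhoffSum_succ']
    exact le_max_of_le_right (add_le_add le_rfl (ih (f x)))

lemma maxBirkhoffSum_le_add_comp (n : ℕ) (x : X) (h : 0 < maxBirkhoffSum f F n x) :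
    maxBirkhoffSum f F n x ≤ F x + maxBirkhoffSum f F n (f x) := by
  cases n with
  | zero => exact absurd h (lt_irrefl _)
  | succ n =>
    have hpos : 0 < F x + maxBirkhoffSum f F n (f x) := by
      simpa [maxBirkhoffSum] using h
    calc maxBirkhoffSum f F (n + 1) x = F x + maxBirkhoffSum f F n (f x) :=
          max_eq_right hpos.le
      _ ≤ _ := add_le_add le_rfl (maxBirkhoffSum_le_succ f F n (f x))

variable {f F}

lemma measurable_maxBirkhoffSum [MeasurableSpace X] (hf : Measurable f) (hF : Measurable F)
    (n : ℕ) : Measurable (maxBirkhoffSum f F n) := by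
  induction n with
  | zero => exact measurable_const
  | succ n ih => exact measurable_const.max (hF.add (ih.comp hf))

lemma integrable_maxBirkhoffSum [MeasurableSpace X] {μ : Measure X}
    (hf : MeasurePreserving f μ μ) (hF : Integrable F μ) (n : ℕ) :
    Integrable (maxBirkhoffSum f F n) μ := by
  induction n with
  | zero => exact integrable_zero _ _ _
  | succ n ih =>
    exact (integrable_zero _ _ _).sup (hF.add (hf.integrable_comp_of_integrable ih))

end MaxBirkhoffSum

/-- The maximal ergodic inequality for Birkhoff sums of bounded length. -/
lemma mul_measureReal_maxBirkhoffSum_pos_le {X : Type*} [MeasurableSpace X] {μ : Measure X}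
    [IsFiniteMeasure μ] {f : X → X} (hf : MeasurePreserving f μ μ) {g : X → ℝ}
    (hgm : Measurable g) (hg : Integrable g μ) (hg0 : ∀ x, 0 ≤ g x) (b : ℝ) (n : ℕ) :
    b * μ.real {x | 0 < maxBirkhoffSum f (fun y => g y - b) n x} ≤ ∫ x, g x ∂μ := by
  set M := maxBirkhoffSum f (fun y => g y - b) n
  have hMm : Measurable M := measurable_maxBirkhoffSum hf.measurable (hgm.sub_const b) n
  have hMi : Integrable M μ := integrable_maxBirkhoffSum hf (hg.sub (integrable_const b)) n
  have hMfi : Integrable (fun x => M (f x)) μ := hf.integrable_comp_of_integrable hMi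
  have hE : MeasurableSet {x | 0 < M x} := measurableSet_lt measurable_const hMm
  have hcomp : ∫ x, M (f x) ∂μ = ∫ x, M x ∂μ := by
    conv_rhs => rw [← hf.map_eq]
    exact (integral_map hf.aemeasurable hMm.aestronglyMeasurable).symm
  have hind : Integrable ({x | 0 < M x}.indicator fun _ => b) μ :=
    (integrable_const b).indicator hE
  have hpt : ∀ x, {x | 0 < M x}.indicator (fun _ => b) x + M x ≤ g x + M (f x) := by
    intro x
    by_cases hx : 0 < M x
    · have := maxBirkhoffSum_le_add_comp f (fun y => g y - b) n x hx
      rw [indicator_of_mem (by exact hx)]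
      linarith
    · rw [indicator_of_notMem (by exact hx)]
      have h1 := maxBirkhoffSum_nonneg f (fun y => g y - b) n (f x)
      have h2 := hg0 x
      linarith
  have hint := integral_mono (hind.add hMi) (hg.add hMfi) hpt
  simp only [Pi.add_apply] at hint
  rw [integral_add hind hMi, integral_add hg hMfi, hcomp, integral_indicator_const b hE,
    smul_eq_mul] at hint
  linarith

/-- The maximal ergodic inequality: for `g ≥ 0` and `b ≥ 0`, the set where some Birkhoff sum of
`g - b` is positive has measure at most `(∫ g) / b`. -/
lemma mul_measureReal_exists_birkhoffSum_pos_le {X : Type*} [MeasurableSpace X] {μ : Measure X}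
    [IsFiniteMeasure μ] {f : X → X} (hf : MeasurePreserving f μ μ) {g : X → ℝ}
    (hgm : Measurable g) (hg : Integrable g μ) (hg0 : ∀ x, 0 ≤ g x) {b : ℝ} (hb : 0 ≤ b) :
    b * μ.real {x | ∃ n, 0 < birkhoffSum f (fun y => g y - b) n x} ≤ ∫ x, g x ∂μ := by
  set E : ℕ → Set X := fun n => {x | 0 < maxBirkhoffSum f (fun y => g y - b) n x}
  have hmono : Monotone E := monotone_nat_of_le_succ fun n x hx =>
    lt_of_lt_of_le hx (maxBirkhoffSum_le_succ f _ n x)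
  have hsub : {x | ∃ n, 0 < birkhoffSum f (fun y => g y - b) n x} ⊆ ⋃ n, E n := by
    rintro x ⟨n, hn⟩
    exact mem_iUnion.2 ⟨n, hn.trans_le (birkhoffSum_le_maxBirkhoffSum f _ n x)⟩
  have htend : Tendsto (fun n => b * μ.real (E n)) atTop (𝓝 (b * μ.real (⋃ n, E n))) :=
    ((ENNReal.tendsto_toReal (measure_ne_top μ _)).comp
      (tendsto_measure_iUnion_atTop hmono)).const_mul b
  calc _ ≤ b * μ.real (⋃ n, E n) := mul_le_mul_of_nonneg_left (measureReal_mono hsub) hb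
    _ ≤ _ := le_of_tendsto' htend fun n =>
      mul_measureReal_maxBirkhoffSum_pos_le hf hgm hg hg0 b n

lemma birkhoffSum_indicator_compl_sub_const {X : Type*} (f : X → X) (H : Set X) (b : ℝ) (n : ℕ)
    (x : X) :
    birkhoffSum f (fun y => Hᶜ.indicator (fun _ => (1 : ℝ)) y - b) n x =
      n * (1 - b) - ((Finset.range n).filter fun i : ℕ => f^[i] x ∈ H).card := by
  have h : ∀ i, Hᶜ.indicator (fun _ => (1 : ℝ)) (f^[i] x) - b =
      (1 - b) - if f^[i] x ∈ H then 1 else 0 := by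
    intro i
    by_cases hi : f^[i] x ∈ H <;> simp [hi]
  simp only [birkhoffSum, h, Finset.sum_sub_distrib, Finset.sum_boole, Finset.sum_const,
    Finset.card_range, nsmul_eq_mul]
  ring

/-- If every Birkhoff sum of `1_{Hᶜ} - b` at `x` is nonpositive, then the lower visit frequency of
the orbit of `x` to `H` is at least `1 - b`. -/
lemma le_liminf_visit_frequency {X : Type*} (f : X → X) (H : Set X) (b : ℝ) (x : X)
    (hx : ∀ n, birkhoffSum f (fun y => Hᶜ.indicator (fun _ => (1 : ℝ)) y - b) n x ≤ 0) :
    1 - b ≤ liminf (fun n : ℕ =>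
      (((Finset.range n).filter fun i : ℕ => f^[i] x ∈ H).card : ℝ) / n) atTop := by
  refine le_liminf_of_le ?_ ?_
  · refine IsBoundedUnder.isCoboundedUnder_ge (isBoundedUnder_of ⟨1, fun n => ?_⟩)
    refine div_le_one_of_le₀ ?_ n.cast_nonneg
    exact_mod_cast (Finset.card_filter_le _ _).trans (Finset.card_range n).le
  · filter_upwards [eventually_gt_atTop 0] with n hn
    have h := hx n
    rw [birkhoffSum_indicator_compl_sub_const] at h
    rw [le_div_iff₀ (by exact_mod_cast hn)]
    linarith

/-- The intermediate claim in the proof of Lemma 3.12: if `μ(H) > 1 − ((1−θ)/2)²`, then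
the set of points whose lower visit frequency to `H` exceeds `(1+θ)/2` has measure
greater than `(1+θ)/2`. -/
theorem stmt_9 {X : Type*} [MeasurableSpace X]
    (μ : Measure X) [IsProbabilityMeasure μ]
    (f : X → X) (hf : MeasurePreserving f μ μ)
    (θ : ℝ) (hθ0 : 0 < θ) (hθ1 : θ < 1)
    (H : Set X) (hH : MeasurableSet H)
    (hμH : ENNReal.ofReal (1 - ((1 - θ) / 2) ^ 2) < μ H) :
    ENNReal.ofReal ((1 + θ) / 2) <
      μ {x : X | (1 + θ) / 2 < liminf (fun n : ℕ =>
          (((Finset.range n).filter fun i : ℕ => f^[i] x ∈ H).card : ℝ) / n) atTop} := by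
  set a : ℝ := (1 - θ) / 2 with ha
  have ha0 : 0 < a := by rw [ha]; linarith
  have hμc : μ.real Hᶜ < a ^ 2 := by
    rw [probReal_compl_eq_one_sub hH]
    have := (ENNReal.ofReal_lt_iff_lt_toReal (by rw [ha]; nlinarith) (measure_ne_top μ H)).1 hμH
    rw [← measureReal_def] at this
    linarith
  obtain ⟨b, hb, hba⟩ : ∃ b, μ.real Hᶜ / a < b ∧ b < a :=
    exists_between ((div_lt_iff₀ ha0).2 (by rwa [← sq]))
  have hb0 : 0 < b := (div_nonneg measureReal_nonneg ha0.le).trans_lt hb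
  rw [div_lt_iff₀ ha0] at hb
  set E := {x | ∃ n, 0 < birkhoffSum f (fun y => Hᶜ.indicator (fun _ => (1 : ℝ)) y - b) n x}
  have hmax : b * μ.real E ≤ μ.real Hᶜ := by
    refine (mul_measureReal_exists_birkhoffSum_pos_le hf (measurable_const.indicator hH.compl)
      ((integrable_const (1 : ℝ)).indicator hH.compl)
      (fun x => indicator_nonneg (fun _ _ => zero_le_one) x) hb0.le).trans_eq ?_
    rw [integral_indicator_const _ hH.compl, smul_eq_mul, mul_one]
  have hEa : μ.real E < a := lt_of_mul_lt_mul_left (hmax.trans_lt hb) hb0.le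
  have hcover : (1 : ℝ) ≤ μ.real E + μ.real Eᶜ := by
    rw [← probReal_univ (μ := μ), ← union_compl_self E]
    exact measureReal_union_le _ _
  have hsub : Eᶜ ⊆ {x : X | (1 + θ) / 2 < liminf (fun n : ℕ =>
      (((Finset.range n).filter fun i : ℕ => f^[i] x ∈ H).card : ℝ) / n) atTop} := by
    intro x hx
    refine lt_of_lt_of_le ?_ (le_liminf_visit_frequency f H b x fun n => ?_)
    · linarith
    · exact not_lt.1 fun h => hx ⟨n, h⟩
  refine lt_of_lt_of_le ?_ (measure_mono hsub)
  rw [ENNReal.ofReal_lt_iff_lt_toReal (by linarith) (measure_ne_top μ _), ← measureReal_def]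
  linarith
end
end

section
/- Let X be a set, f : X → X a bijection, N ≥ 1 an integer, and R ⊆ X a subset with f^N(R) = R such that the sets R, f(R), …, f^{N−1}(R) are pairwise disjoint. Let T : R → [1,∞) be a function such that lim_{k→±∞} (1/|k|) · log T(f^{kN}(y)) = 0 for every y ∈ R. Set S = ⋃_{i=0}^{N−1} fⁱ(R); for x ∈ S let κ(x) ∈ {0,…,N−1} be the unique index with f^{−κ(x)}(x) ∈ R, and for a constant C > 0 define δ(x) = C · T(f^{−κ(x)}(x))⁻¹. Then S satisfies f(S) = S, and for every x ∈ S one has lim_{n→±∞} (1/|n|) · log δ(fⁿ(x)) = 0. (This is the sub-exponential variation claim established in the proof of item (3) of Theorem A of the paper.) -/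
open Set Filter Topology

noncomputable section

/-- Sub-linear growth is preserved by an affine reindexing and by subtracting from a constant. -/
lemma tendsto_const_sub_comp_ediv_div_abs {l : Filter ℤ}
    (habs : Tendsto (fun n : ℤ => |(n : ℝ)|) l atTop)
    (m : ℤ) {N : ℤ} (hq : Tendsto (fun n : ℤ => (n + m) / N) l l)
    {a : ℤ → ℝ} (ha : Tendsto (fun k : ℤ => a k / |(k : ℝ)|) l (𝓝 0)) (c : ℝ) :
    Tendsto (fun n : ℤ => (c - a ((n + m) / N)) / |(n : ℝ)|) l (𝓝 0) := by
  have hc : Tendsto (fun n : ℤ => c / |(n : ℝ)|) l (𝓝 0) := habs.const_div_atTop c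
  have hbound : Tendsto
      (fun n : ℤ => (1 + |(m : ℝ)|) * |(a ((n + m) / N) / |(((n + m) / N : ℤ) : ℝ)|)|)
      l (𝓝 0) := by
    simpa using ((ha.comp hq).abs).const_mul (1 + |(m : ℝ)|)
  have hmain : Tendsto (fun n : ℤ => a ((n + m) / N) / |(n : ℝ)|) l (𝓝 0) := by
    refine squeeze_zero_norm' ?_ hbound
    filter_upwards [habs.eventually_ge_atTop 1, (habs.comp hq).eventually_ge_atTop 1]
      with n hn hk
    simp only [Function.comp_apply] at hk
    have hle : |(((n + m) / N : ℤ) : ℝ)| ≤ |(n : ℝ)| + |(m : ℝ)| := by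
      exact_mod_cast (Int.abs_ediv_le_abs (n + m) N).trans (abs_add_le n m)
    generalize (n + m) / N = k at *
    rw [Real.norm_eq_abs, abs_div, abs_div, abs_abs, abs_abs, mul_div_assoc',
      div_le_div_iff₀ (by linarith) (by linarith)]
    have h : |(k : ℝ)| ≤ (1 + |(m : ℝ)|) * |(n : ℝ)| := by
      nlinarith [abs_nonneg (m : ℝ)]
    nlinarith [mul_le_mul_of_nonneg_left h (abs_nonneg (a k))]
  simpa [sub_div] using hc.sub hmain

lemma Int.tendsto_add_ediv_atTop (m : ℤ) {N : ℤ} (hN : 0 < N) :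
    Tendsto (fun n : ℤ => (n + m) / N) atTop atTop := by
  refine tendsto_atTop.2 fun b => ?_
  filter_upwards [eventually_ge_atTop (b * N - m)] with n hn
  exact (Int.le_ediv_iff_mul_le hN).2 (by linarith)

lemma Int.tendsto_add_ediv_atBot (m : ℤ) {N : ℤ} (hN : 0 < N) :
    Tendsto (fun n : ℤ => (n + m) / N) atBot atBot := by
  refine tendsto_atBot.2 fun b => ?_
  filter_upwards [eventually_le_atBot (b * N - m)] with n hn
  exact Int.ediv_le_of_le_mul hN (by linarith)

lemma Equiv.Perm.zpow_apply_mem_of_image_eq {X : Type*} {g : Equiv.Perm X} {R : Set X}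
    (hR : g '' R = R) (k : ℤ) {y : X} (hy : y ∈ R) : (g ^ k) y ∈ R := by
  have h1 : ∀ z ∈ R, g z ∈ R := fun z hz => hR ▸ mem_image_of_mem g hz
  have h2 : ∀ z ∈ R, g⁻¹ z ∈ R := by
    intro z hz
    rw [← hR] at hz
    obtain ⟨w, hw, rfl⟩ := hz
    simpa using hw
  induction k with
  | zero => simpa using hy
  | succ k ih =>
    rw [add_comm, zpow_add, zpow_one, Equiv.Perm.mul_apply]
    exact h1 _ ih
  | pred k ih =>
    rw [sub_eq_add_neg, add_comm, zpow_add, zpow_neg_one, Equiv.Perm.mul_apply]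
    exact h2 _ ih

/-- The sub-exponential variation claim from the proof of Theorem A(3): if `R` is
`f^N`-invariant with `R, f(R), …, f^{N−1}(R)` pairwise disjoint and `T : R → [1,∞)` is
tempered along `f^N`-orbits, then `S = ⋃_{i<N} fⁱ(R)` is `f`-invariant and the function
`δ(x) = C · T(f^{−κ(x)}(x))⁻¹` (where `κ(x) < N` is the unique index with
`f^{−κ(x)}(x) ∈ R`) varies sub-exponentially along the full `f`-orbit of every `x ∈ S`. -/
theorem stmt_12 {X : Type*} (f : Equiv.Perm X) (N : ℕ) (hN : 1 ≤ N)
    (R : Set X) (hR : ⇑(f ^ N) '' R = R)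
    (hdisj : ∀ i j : ℕ, i < N → j < N → i ≠ j → Disjoint (⇑(f ^ i) '' R) (⇑(f ^ j) '' R))
    (T : X → ℝ) (hT1 : ∀ y ∈ R, 1 ≤ T y)
    (htemp : ∀ y ∈ R,
      Tendsto (fun k : ℤ =>
        Real.log (T ((f ^ (k * (N : ℤ))) y)) / |(k : ℝ)|) atTop (𝓝 0) ∧
      Tendsto (fun k : ℤ =>
        Real.log (T ((f ^ (k * (N : ℤ))) y)) / |(k : ℝ)|) atBot (𝓝 0))
    (C : ℝ) (hC : 0 < C)
    (S : Set X) (hS : S = ⋃ i ∈ Finset.range N, ⇑(f ^ i) '' R)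
    (δ : X → ℝ)
    (hδ : ∀ x ∈ S, ∀ i : ℕ, i < N → (f ^ (-(i : ℤ))) x ∈ R →
      δ x = C * (T ((f ^ (-(i : ℤ))) x))⁻¹) :
    ⇑f '' S = S ∧
    ∀ x ∈ S,
      Tendsto (fun n : ℤ => Real.log (δ ((f ^ n) x)) / |(n : ℝ)|) atTop (𝓝 0) ∧
      Tendsto (fun n : ℤ => Real.log (δ ((f ^ n) x)) / |(n : ℝ)|) atBot (𝓝 0) := by
  have hN0 : (0 : ℤ) < N := by exact_mod_cast hN
  have hmemR : ∀ y ∈ R, ∀ k : ℤ, (f ^ (k * (N : ℤ))) y ∈ R := by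
    intro y hy k
    rw [mul_comm, zpow_mul, zpow_natCast]
    exact Equiv.Perm.zpow_apply_mem_of_image_eq hR k hy
  have hsplit : ∀ (m : ℤ) (y : X),
      (f ^ (m % N).toNat) ((f ^ (m / N * (N : ℤ))) y) = (f ^ m) y := by
    intro m y
    rw [← zpow_natCast, Int.toNat_of_nonneg (Int.emod_nonneg _ hN0.ne'),
      ← Equiv.Perm.mul_apply, ← zpow_add, mul_comm, Int.emod_add_mul_ediv]
  have hlt : ∀ m : ℤ, (m % N).toNat < N := by
    intro m
    have := Int.emod_lt_of_pos m hN0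
    omega
  have hmemS : ∀ y ∈ R, ∀ m : ℤ, (f ^ m) y ∈ S := by
    intro y hy m
    rw [hS]
    exact mem_biUnion (Finset.mem_range.2 (hlt m)) ⟨_, hmemR y hy (m / N), hsplit m y⟩
  have hexists : ∀ x ∈ S, ∃ m : ℤ, ∃ y ∈ R, (f ^ m) y = x := by
    intro x hx
    rw [hS] at hx
    simp only [mem_iUnion] at hx
    obtain ⟨i, -, y, hy, rfl⟩ := hx
    exact ⟨i, y, hy, by rw [zpow_natCast]⟩
  have hδ_orbit : ∀ y ∈ R, ∀ m : ℤ,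
      Real.log (δ ((f ^ m) y)) =
        Real.log C - Real.log (T ((f ^ (m / N * (N : ℤ))) y)) := by
    intro y hy m
    have hback : (f ^ (-((m % N).toNat : ℤ))) ((f ^ m) y) = (f ^ (m / N * (N : ℤ))) y := by
      rw [← hsplit m y, zpow_neg, zpow_natCast]
      exact Equiv.symm_apply_apply _ _
    have hmem := hmemR y hy (m / N)
    rw [hδ _ (hmemS y hy m) _ (hlt m) (hback ▸ hmem), hback,
      Real.log_mul hC.ne' (inv_ne_zero (by linarith [hT1 _ hmem])), Real.log_inv,
      sub_eq_add_neg]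
  refine ⟨Subset.antisymm ?_ ?_, ?_⟩
  · rintro _ ⟨x, hx, rfl⟩
    obtain ⟨m, y, hy, rfl⟩ := hexists x hx
    rw [← Equiv.Perm.mul_apply, ← zpow_one_add]
    exact hmemS y hy _
  · intro x hx
    obtain ⟨m, y, hy, rfl⟩ := hexists x hx
    refine ⟨_, hmemS y hy (m - 1), ?_⟩
    rw [← Equiv.Perm.mul_apply, ← zpow_one_add, add_sub_cancel]
  · intro x hx
    obtain ⟨m, y, hy, rfl⟩ := hexists x hx
    simp_rw [← Equiv.Perm.mul_apply, ← zpow_add, hδ_orbit y hy]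
    exact ⟨tendsto_const_sub_comp_ediv_div_abs
        (tendsto_abs_atTop_atTop.comp tendsto_intCast_atTop_atTop) m
        (Int.tendsto_add_ediv_atTop m hN0) (htemp y hy).1 _,
      tendsto_const_sub_comp_ediv_div_abs
        (tendsto_abs_atBot_atTop.comp (tendsto_intCast_atBot_iff.2 tendsto_id)) m
        (Int.tendsto_add_ediv_atBot m hN0) (htemp y hy).2 _⟩
end
end
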